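/- There is no uniquely C4+-saturated graph containing exactly three triangles. -/

import Mathlib

open SimpleGraph

/-- The diamond graph `C₄⁺`: a `4`-cycle with one chord, i.e. `K₄` minus an edge. -/
def diamond : SimpleGraph (Fin 4) := (⊤ : SimpleGraph (Fin 4)).deleteEdges {s(0, 1)}

/-- `G'` is a copy of `H` in `G`, i.e. a subgraph of `G` isomorphic to `H`. -/
def IsCopy {W V : Type*} (H : SimpleGraph W) {G : SimpleGraph V} (G' : G.Subgraph) : Prop :=
  Nonempty (G'.coe ≃g H)

/-- `G` is uniquely `H`-saturated: `G` is `H`-free, and adding any non-edge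
creates exactly one copy of `H`. -/
def UniquelySaturated {W V : Type*} (H : SimpleGraph W) (G : SimpleGraph V) : Prop :=
  (∀ G' : G.Subgraph, ¬ IsCopy H G') ∧
    ∀ u v : V, u ≠ v → ¬ G.Adj u v →
      ∃! G' : (G ⊔ SimpleGraph.fromEdgeSet {s(u, v)}).Subgraph, IsCopy H G'

lemma exists_copy {V : Type*} (H : SimpleGraph V) {p q r s : V} (hpq : p ≠ q)
    (h1 : H.Adj p r) (h2 : H.Adj p s) (h3 : H.Adj q r) (h4 : H.Adj q s) (h5 : H.Adj r s) :
    ∃ G' : H.Subgraph, IsCopy diamond G' ∧ G'.verts = {p, q, r, s} := by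
  let f : diamond →g H :=
    { toFun := ![p, q, r, s]
      map_rel' := by
        intro a b hab
        fin_cases a <;> fin_cases b <;> simp [diamond] at hab ⊢ <;>
          first | assumption | (apply SimpleGraph.Adj.symm; assumption) }
  have hf : Function.Injective f := by
    intro a b hab
    have e1 := h1.ne
    have e2 := h2.ne
    have e3 := h3.ne
    have e4 := h4.ne
    have e5 := h5.ne
    change (![p, q, r, s] : Fin 4 → V) a = (![p, q, r, s] : Fin 4 → V) b at hab
    fin_cases a <;> fin_cases b <;> simp at hab ⊢ <;> simp_all
  let c : SimpleGraph.Copy diamond H := ⟨f, hf⟩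
  refine ⟨c.toSubgraph, ⟨c.isoToSubgraph.symm⟩, ?_⟩
  ext x
  simp [SimpleGraph.Copy.toSubgraph, c, f]
  grind

lemma of_copy {V : Type*} {H : SimpleGraph V} {G' : H.Subgraph} (h : IsCopy diamond G') :
    ∃ p q r s, p ≠ q ∧ H.Adj p r ∧ H.Adj p s ∧ H.Adj q r ∧ H.Adj q s ∧ H.Adj r s := by
  obtain ⟨e⟩ := h
  have key : ∀ i j : Fin 4, diamond.Adj i j → H.Adj (e.symm i : V) (e.symm j) := by
    intro i j hij
    have : G'.coe.Adj (e.symm i) (e.symm j) := e.symm.map_adj_iff.2 hij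
    exact G'.adj_sub this
  refine ⟨e.symm 0, e.symm 1, e.symm 2, e.symm 3, ?_, key _ _ ?_, key _ _ ?_, key _ _ ?_,
    key _ _ ?_, key _ _ ?_⟩
  · intro h
    have := e.symm.injective (Subtype.ext h)
    simp at this
  all_goals simp [diamond]

/-- local reformulation of being uniquely diamond-saturated -/
structure Loc {V : Type*} (G : SimpleGraph V) : Prop where
  free : ∀ p q r s, p ≠ q → G.Adj p r → G.Adj p s → G.Adj q r → G.Adj q s → G.Adj r s → False
  ex : ∀ u v, u ≠ v → ¬ G.Adj u v →
    (∃ a b, a ≠ b ∧ G.Adj u a ∧ G.Adj v a ∧ G.Adj u b ∧ G.Adj v b) ∨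
    (∃ w x, G.Adj u w ∧ G.Adj v w ∧ G.Adj w x ∧ (G.Adj u x ∨ G.Adj v x))
  u3 : ∀ u v a b c, u ≠ v → ¬ G.Adj u v → G.Adj u a → G.Adj v a → G.Adj u b → G.Adj v b →
    G.Adj u c → G.Adj v c → a ≠ b → a ≠ c → b ≠ c → False
  u2 : ∀ u v a b x, u ≠ v → ¬ G.Adj u v → G.Adj u a → G.Adj v a → G.Adj u b → G.Adj v b →
    a ≠ b → G.Adj u x → G.Adj a x → False
  u1 : ∀ u v w x y, u ≠ v → ¬ G.Adj u v → G.Adj u w → G.Adj v w →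
    G.Adj u x → G.Adj w x → G.Adj v y → G.Adj w y → False

lemma loc_of_sat {V : Type*} (G : SimpleGraph V) (h : UniquelySaturated diamond G) : Loc G := by
  obtain ⟨hf, hs⟩ := h
  have free : ∀ p q r s, p ≠ q → G.Adj p r → G.Adj p s → G.Adj q r → G.Adj q s → G.Adj r s →
      False := by
    intro p q r s h0 h1 h2 h3 h4 h5
    obtain ⟨G', h, -⟩ := exists_copy G h0 h1 h2 h3 h4 h5
    exact hf G' h
  have uni : ∀ u v, u ≠ v → ¬ G.Adj u v → ∀ p q r s p' q' r' s',
      ∀ H, H = G ⊔ SimpleGraph.fromEdgeSet {s(u, v)} → p ≠ q →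
      H.Adj p r → H.Adj p s → H.Adj q r → H.Adj q s → H.Adj r s → p' ≠ q' →
      H.Adj p' r' → H.Adj p' s' → H.Adj q' r' → H.Adj q' s' → H.Adj r' s' →
      ({p, q, r, s} : Set V) = {p', q', r', s'} := by
    intro u v huv hn p q r s p' q' r' s' H hH h0 h1 h2 h3 h4 h5 k0 k1 k2 k3 k4 k5
    subst hH
    obtain ⟨A, hA, hA'⟩ := exists_copy _ h0 h1 h2 h3 h4 h5
    obtain ⟨B, hB, hB'⟩ := exists_copy _ k0 k1 k2 k3 k4 k5
    rw [← hA', ← hB', (hs u v huv hn).unique hA hB]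
  have old : ∀ u v a b, G.Adj a b → (G ⊔ SimpleGraph.fromEdgeSet {s(u, v)}).Adj a b :=
    fun u v a b h => Or.inl h
  have new : ∀ u v, u ≠ v → (G ⊔ SimpleGraph.fromEdgeSet {s(u, v)}).Adj u v := by
    intro u v h
    simp [h]
  refine ⟨free, ?_, ?_, ?_, ?_⟩
  · intro u v huv hn
    obtain ⟨G', hG', -⟩ := hs u v huv hn
    obtain ⟨p, q, r, s, h0, h1, h2, h3, h4, h5⟩ := of_copy hG'
    have e : ∀ a b, (G ⊔ SimpleGraph.fromEdgeSet {s(u, v)}).Adj a b →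
        G.Adj a b ∨ (a = u ∧ b = v) ∨ (a = v ∧ b = u) := by
      intro a b h
      simp at h
      tauto
    have n1 := h1.ne
    have n2 := h2.ne
    have n3 := h3.ne
    have n4 := h4.ne
    have n5 := h5.ne
    replace h1 := e _ _ h1
    replace h2 := e _ _ h2
    replace h3 := e _ _ h3
    replace h4 := e _ _ h4
    replace h5 := e _ _ h5
    clear e old new uni hs hf
    have symm : ∀ a b, G.Adj a b → G.Adj b a := fun a b h => h.symm
    by_cases g5 : G.Adj r s
    · right
      by_cases g1 : G.Adj p r
      · by_cases g2 : G.Adj p s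
        · by_cases g3 : G.Adj q r
          · have g4 : ¬ G.Adj q s := fun g4 => free p q r s h0 g1 g2 g3 g4 g5
            refine ⟨r, p, ?_⟩
            grind
          · refine ⟨s, p, ?_⟩
            grind
        · refine ⟨r, q, ?_⟩
          grind
      · refine ⟨s, q, ?_⟩
        grind
    · left
      refine ⟨p, q, h0, ?_⟩
      grind
  · intro u v a b c huv hn h1 h2 h3 h4 h5 h6 hab hac hbc
    have := uni u v huv hn a b u v a c u v _ rfl hab (old _ _ _ _ h1.symm) (old _ _ _ _ h2.symm)
      (old _ _ _ _ h3.symm) (old _ _ _ _ h4.symm) (new _ _ huv) hac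
      (old _ _ _ _ h1.symm) (old _ _ _ _ h2.symm)
      (old _ _ _ _ h5.symm) (old _ _ _ _ h6.symm) (new _ _ huv)
    have hb : b ∈ ({a, c, u, v} : Set V) := by rw [← this]; simp
    simp at hb
    have := h3.ne
    have := h4.ne
    grind
  · intro u v a b x huv hn h1 h2 h3 h4 hab h5 h6
    have hxv : x ≠ v := by rintro rfl; exact hn h5
    have := uni u v huv hn a b u v x v u a _ rfl hab (old _ _ _ _ h1.symm) (old _ _ _ _ h2.symm)
      (old _ _ _ _ h3.symm) (old _ _ _ _ h4.symm) (new _ _ huv) hxv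
      (old _ _ _ _ h5.symm) (old _ _ _ _ h6.symm)
      (new _ _ huv).symm (old _ _ _ _ h2) (old _ _ _ _ h1)
    have hb : b ∈ ({x, v, u, a} : Set V) := by rw [← this]; simp
    simp at hb
    have := h3.ne
    have := h4.ne
    rcases hb with rfl | hb
    · exact free u v a b huv h1 h3 h2 h4 h6
    · grind
  · intro u v w x y huv hn h1 h2 h3 h4 h5 h6
    have hxv : x ≠ v := by rintro rfl; exact hn h3
    have hyu : y ≠ u := by rintro rfl; exact hn h5.symm
    have := uni u v huv hn x v u w y u v w _ rfl hxv (old _ _ _ _ h3.symm) (old _ _ _ _ h4.symm)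
      (new _ _ huv).symm (old _ _ _ _ h2) (old _ _ _ _ h1) hyu
      (old _ _ _ _ h5.symm) (old _ _ _ _ h6.symm)
      (new _ _ huv) (old _ _ _ _ h1) (old _ _ _ _ h2)
    have hb : x ∈ ({y, u, v, w} : Set V) := by rw [← this]; simp
    simp at hb
    have := h3.ne
    have := h4.ne
    rcases hb with rfl | hb
    · exact free u v w x huv h1 h3 h2 h5 h4
    · grind

section Main

open scoped Classical
open Finset

variable {V : Type*} {G : SimpleGraph V}

/-- triangle edges -/
def TE (G : SimpleGraph V) (u v : V) : Prop := G.Adj u v ∧ ∃ x, G.Adj u x ∧ G.Adj v x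

/-- edges in no triangle -/
def NE (G : SimpleGraph V) (u v : V) : Prop := G.Adj u v ∧ ∀ x, G.Adj u x → ¬ G.Adj v x

lemma NE.symm {u v : V} (h : NE G u v) : NE G v u := ⟨h.1.symm, fun x a b => h.2 x b a⟩

lemma TE.symm {u v : V} (h : TE G u v) : TE G v u :=
  ⟨h.1.symm, h.2.imp fun _ a => ⟨a.2, a.1⟩⟩

lemma te_or_ne {u v : V} (h : G.Adj u v) : TE G u v ∨ NE G u v := by
  by_cases hx : ∃ x, G.Adj u x ∧ G.Adj v x
  · exact Or.inl ⟨h, hx⟩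
  · push Not at hx
    exact Or.inr ⟨h, hx⟩

lemma TE.not_ne {u v : V} (h : TE G u v) : ¬ NE G u v := by
  obtain ⟨-, x, a, b⟩ := h
  exact fun h => h.2 x a b

/-- two triangle edges at a vertex span a triangle -/
lemma Loc.tt (L : Loc G) {u w v : V} (h : TE G u w) (h' : TE G w v) (huv : u ≠ v) :
    G.Adj u v := by
  by_contra hn
  obtain ⟨h1, x, h2, h3⟩ := h
  obtain ⟨k1, y, k2, k3⟩ := h'
  exact L.u1 u v w x y huv hn h1 k1.symm h2 h3 k3 k2

variable [Fintype V]

/-- degree in the graph of non-triangle edges -/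
noncomputable def nd (G : SimpleGraph V) (v : V) : ℕ := #{w | NE G v w}
/-- degree in the graph of triangle edges -/
noncomputable def td (G : SimpleGraph V) (v : V) : ℕ := #{w | TE G v w}

lemma Loc.nd_le (L : Loc G) {u v : V} (h : NE G u v) : nd G u ≤ nd G v := by
  have key : #(({w | NE G u w} : Finset V).erase v) ≤ #(({w | NE G v w} : Finset V).erase u) := by
    apply Finset.card_le_card_of_forall_subsingleton (fun a b => G.Adj a b)
    · intro w hw
      simp at hw
      obtain ⟨hwv, hw⟩ := hw
      have hn : ¬ G.Adj w v := fun k => h.2 w hw.1 k.symm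
      have main : ∃ b, b ≠ u ∧ G.Adj w b ∧ G.Adj v b := by
        rcases L.ex w v hwv hn with ⟨a, b, hab, h1, h2, h3, h4⟩ | ⟨a, x, h1, h2, h3, h4⟩
        · by_cases hau : a = u
          · exact ⟨b, fun k => hab (hau.trans k.symm), h3, h4⟩
          · exact ⟨a, hau, h1, h2⟩
        · by_cases hau : a = u
          · subst hau
            rcases h4 with h4 | h4
            · exact (hw.2 x h3 h4).elim
            · exact (h.2 x h3 h4).elim
          · exact ⟨a, hau, h1, h2⟩
      obtain ⟨b, hbu, h1, h2⟩ := main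
      refine ⟨b, ?_, h1⟩
      simp only [mem_erase, mem_filter, mem_univ, true_and]
      refine ⟨hbu, (te_or_ne h2).resolve_left ?_⟩
      rintro ⟨-, x, h5, h6⟩
      exact L.u2 v w b u x (Ne.symm hwv) (fun k => hn k.symm) h2 h1 h.1.symm hw.1.symm hbu h5 h6
    · intro b hb
      simp at hb
      intro a ha a' ha'
      simp at ha ha'
      by_contra hne
      exact L.u3 u b a a' v (Ne.symm hb.1) (fun k => h.2 b k hb.2.1) ha.1.2.1 ha.2.symm ha'.1.2.1
        ha'.2.symm h.1 hb.2.1.symm hne ha.1.1 ha'.1.1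
  have h1 := Finset.card_erase_add_one (s := ({w | NE G u w} : Finset V)) (a := v) (by simpa)
  have h2 := Finset.card_erase_add_one (s := ({w | NE G v w} : Finset V)) (a := u)
    (by simpa using h.symm)
  unfold nd
  omega

lemma Loc.nd_eq (L : Loc G) {u v : V} (h : NE G u v) : nd G u = nd G v :=
  le_antisymm (L.nd_le h) (L.nd_le h.symm)

/-- weighted number of 2-paths from `v` to `u` -/
noncomputable def wt (G : SimpleGraph V) (v u : V) : ℕ :=
  2 * #{w | TE G v w ∧ NE G w u} + 2 * #{w | NE G v w ∧ TE G w u} + #{w | NE G v w ∧ NE G w u}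

lemma Loc.wt_nonadj (L : Loc G) {v u : V} (hne : v ≠ u) (hn : ¬ G.Adj v u) : wt G v u = 2 := by
  have hn' : ¬ G.Adj u v := fun k => hn k.symm
  rcases L.ex v u hne hn with ⟨a, b, hab, h1, h2, h3, h4⟩ | ⟨w, x, h1, h2, h3, h4⟩
  · have hc : ∀ w, G.Adj v w → G.Adj u w → w = a ∨ w = b := by
      intro w k1 k2
      by_contra hh
      push Not at hh
      exact L.u3 v u a b w hne hn h1 h2 h3 h4 k1 k2 hab (Ne.symm hh.1) (Ne.symm hh.2)
    have nt : ∀ w, G.Adj v w → G.Adj u w → ¬ TE G v w ∧ ¬ TE G w u := by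
      intro w k1 k2
      have : ∃ w', w ≠ w' ∧ G.Adj v w' ∧ G.Adj u w' := by
        rcases hc w k1 k2 with rfl | rfl
        · exact ⟨b, hab, h3, h4⟩
        · exact ⟨a, hab.symm, h1, h2⟩
      obtain ⟨w', m0, m1, m2⟩ := this
      constructor
      · rintro ⟨-, x, k3, k4⟩
        exact L.u2 v u w w' x hne hn k1 k2 m1 m2 m0 k3 k4
      · rintro ⟨-, x, k3, k4⟩
        exact L.u2 u v w w' x hne.symm hn' k2 k1 m2 m1 m0 k4 k3
    have e1 : ({w | TE G v w ∧ NE G w u} : Finset V) = ∅ := by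
      ext w
      simp
      exact fun k k' => (nt w k.1 k'.1.symm).1 k
    have e2 : ({w | NE G v w ∧ TE G w u} : Finset V) = ∅ := by
      ext w
      simp
      exact fun k k' => (nt w k.1 k'.1.symm).2 k'
    have e3 : ({w | NE G v w ∧ NE G w u} : Finset V) = {a, b} := by
      ext w
      simp
      constructor
      · exact fun k => hc w k.1.1 k.2.1.symm
      · have : ∀ w, G.Adj v w → G.Adj u w → NE G v w ∧ NE G w u := fun w k1 k2 =>
          ⟨(te_or_ne k1).resolve_left (nt w k1 k2).1,
            (te_or_ne k2.symm).resolve_left (nt w k1 k2).2⟩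
        rintro (rfl | rfl)
        · exact this _ h1 h2
        · exact this _ h3 h4
    simp [wt, e1, e2, e3, hab]
  · have hT : TE G v w ∨ TE G w u := by
      rcases h4 with h4 | h4
      · exact Or.inl ⟨h1, x, h4, h3⟩
      · exact Or.inr ⟨h2.symm, x, h3, h4⟩
    have hc : ∀ w', G.Adj v w' → G.Adj u w' → w' = w := by
      intro w' k1 k2
      by_contra hh
      rcases hT with ⟨-, x, k3, k4⟩ | ⟨-, x, k3, k4⟩
      · exact L.u2 v u w w' x hne hn h1 h2 k1 k2 (Ne.symm hh) k3 k4
      · exact L.u2 u v w w' x hne.symm hn' h2 h1 k2 k1 (Ne.symm hh) k4 k3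
    have fl : ∀ P Q : V → V → Prop, (∀ a b, P a b → G.Adj a b) → (∀ a b, Q a b → G.Adj a b) →
        #({w' | P v w' ∧ Q w' u} : Finset V) = if P v w ∧ Q w u then 1 else 0 := by
      intro P Q hP hQ
      split_ifs with hh
      · rw [card_eq_one]
        refine ⟨w, ?_⟩
        ext w'
        simp
        constructor
        · exact fun k => hc w' (hP _ _ k.1) (hQ _ _ k.2).symm
        · rintro rfl
          exact hh
      · rw [card_eq_zero]
        ext w'
        simp
        intro k1 k2
        have := hc w' (hP _ _ k1) (hQ _ _ k2).symm
        subst this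
        exact hh ⟨k1, k2⟩
    have hTadj : ∀ a b, TE G a b → G.Adj a b := fun a b k => k.1
    have hNadj : ∀ a b, NE G a b → G.Adj a b := fun a b k => k.1
    unfold wt
    rw [fl _ _ hTadj hNadj, fl _ _ hNadj hTadj, fl _ _ hNadj hNadj]
    have tt : ¬ (TE G v w ∧ TE G w u) := fun k => hn (L.tt k.1 k.2 hne)
    have a1 := te_or_ne h1
    have a2 := te_or_ne h2.symm
    have b1 : TE G v w → ¬ NE G v w := TE.not_ne
    have b2 : TE G w u → ¬ NE G w u := TE.not_ne
    grind

lemma wt_adj {v u : V} (h : G.Adj v u) : wt G v u = 0 := by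
  have e1 : ({w | TE G v w ∧ NE G w u} : Finset V) = ∅ := by
    ext w
    simp
    exact fun k k' => k'.2 v k.1.symm h.symm
  have e2 : ({w | NE G v w ∧ TE G w u} : Finset V) = ∅ := by
    ext w
    simp
    exact fun k k' => k.2 u h k'.1
  have e3 : ({w | NE G v w ∧ NE G w u} : Finset V) = ∅ := by
    ext w
    simp
    exact fun k k' => k.2 u h k'.1
  simp [wt, e1, e2, e3]

lemma wt_self (v : V) : wt G v v = nd G v := by
  have e1 : ({w | TE G v w ∧ NE G w v} : Finset V) = ∅ := by
    ext w
    simp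
    exact fun k k' => k.not_ne k'.symm
  have e2 : ({w | NE G v w ∧ TE G w v} : Finset V) = ∅ := by
    ext w
    simp
    exact fun k k' => k'.not_ne k.symm
  have e3 : ({w | NE G v w ∧ NE G w v} : Finset V) = ({w | NE G v w} : Finset V) := by
    ext w
    simp
    exact fun k => k.symm
  simp [wt, e1, e2, e3, nd]

lemma sum_paths (P : V → Prop) (Q : V → V → Prop) :
    ∑ u, #({w | P w ∧ Q w u} : Finset V) = ∑ w with P w, #({u | Q w u} : Finset V) := by
  simp only [card_filter]
  rw [sum_comm, sum_filter]
  apply sum_congr rfl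
  intro w _
  split_ifs with h <;> simp [h]

lemma card_adj (v : V) : #({u | G.Adj v u} : Finset V) = nd G v + td G v := by
  unfold nd td
  rw [← card_union_of_disjoint]
  · congr 1
    ext u
    simp
    constructor
    · exact fun h => (te_or_ne h).symm
    · rintro (h | h)
      · exact h.1
      · exact h.1
  · rw [Finset.disjoint_left]
    intro u h1 h2
    simp at h1 h2
    exact h2.not_ne h1

lemma Loc.count (L : Loc G) (v : V) :
    2 * (∑ w with TE G v w, nd G w) + 2 * (∑ w with NE G v w, td G w) + nd G v * nd G v
      + 2 + 2 * nd G v + 2 * td G v = 2 * Fintype.card V + nd G v := by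
  have h : ∀ u, wt G v u + (if v = u then 2 else 0) + 2 * (if G.Adj v u then 1 else 0)
      = 2 + (if v = u then nd G v else 0) := by
    intro u
    by_cases h : v = u
    · subst h
      simp [wt_self, add_comm]
    · by_cases h' : G.Adj v u
      · simp [h, h', wt_adj]
      · simp [h, h', L.wt_nonadj]
  have hs := Finset.sum_congr (rfl : (univ : Finset V) = univ) (fun u _ => h u)
  simp only [sum_add_distrib, ← mul_sum, ← card_filter, card_adj, sum_ite_eq, mem_univ, if_true,
    wt, sum_paths] at hs
  have h3 : ∑ w with NE G v w, #({u | NE G w u} : Finset V) = nd G v * nd G v := by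
    rw [sum_congr rfl (g := fun _ => nd G v)]
    · simp [nd]
    · intro w hw
      simp at hw
      exact (L.nd_eq hw).symm
  rw [h3] at hs
  simp only [sum_const, card_univ, smul_eq_mul] at hs
  unfold td nd at *
  omega

lemma Loc.main (L : Loc G) (hcount : (G.cliqueSet 3).ncard = 3) : False := by
  set T : Finset (Finset V) := G.cliqueFinset 3 with hT
  have hT3 : #T = 3 := by
    rw [← hcount, ← SimpleGraph.coe_cliqueFinset, Set.ncard_coe_finset]
  have memT : ∀ A, A ∈ T ↔ G.IsNClique 3 A := fun A => by simp [hT]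
  have cardA : ∀ A ∈ T, #A = 3 := fun A hA => ((memT A).1 hA).card_eq
  have adjA : ∀ A ∈ T, ∀ a ∈ A, ∀ b ∈ A, a ≠ b → G.Adj a b := fun A hA a ha b hb hab =>
    ((memT A).1 hA).isClique ha hb hab
  have teA : ∀ A ∈ T, ∀ a ∈ A, ∀ b ∈ A, a ≠ b → TE G a b := by
    intro A hA a ha b hb hab
    refine ⟨adjA A hA a ha b hb hab, ?_⟩
    have : ∃ c ∈ A, c ∉ ({a, b} : Finset V) := by
      apply exists_mem_notMem_of_card_lt_card
      rw [cardA A hA, card_pair hab]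
      norm_num
    obtain ⟨c, hc, hc'⟩ := this
    simp at hc'
    exact ⟨c, adjA A hA a ha c hc (Ne.symm hc'.1), adjA A hA b hb c hc (Ne.symm hc'.2)⟩
  have mkT : ∀ x y z, G.Adj x y → G.Adj x z → G.Adj y z → ({x, y, z} : Finset V) ∈ T := by
    intro x y z h1 h2 h3
    rw [memT, SimpleGraph.is3Clique_triple_iff]
    exact ⟨h1, h2, h3⟩
  have memA : ∀ A ∈ T, ∀ a ∈ A, ∀ w, w ∈ A ↔ w = a ∨ TE G a w := by
    intro A hA a ha w
    constructor
    · intro hw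
      by_cases h : w = a
      · exact Or.inl h
      · exact Or.inr (teA A hA a ha w hw (Ne.symm h))
    · rintro (rfl | h)
      · exact ha
      · by_contra hw
        have : ∃ b ∈ A, b ≠ a := exists_mem_ne (by rw [cardA A hA]; norm_num) a
        obtain ⟨b, hb, hba⟩ := this
        have : ∃ c ∈ A, c ∉ ({a, b} : Finset V) := by
          apply exists_mem_notMem_of_card_lt_card
          rw [cardA A hA, card_pair hba.symm]
          norm_num
        obtain ⟨c, hc, hc'⟩ := this
        simp at hc'
        have hwb : b ≠ w := by rintro rfl; exact hw hb
        have hwc : c ≠ w := by rintro rfl; exact hw hc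
        have hbw : G.Adj b w := L.tt (teA A hA b hb a ha hba) h hwb
        exact L.free c w a b hwc (adjA A hA c hc a ha hc'.1) (adjA A hA c hc b hb hc'.2)
          h.1.symm hbw.symm (adjA A hA a ha b hb hba.symm)
  have disj : ∀ A ∈ T, ∀ B ∈ T, ∀ a, a ∈ A → a ∈ B → A = B := by
    intro A hA B hB a h1 h2
    ext w
    rw [memA A hA a h1, memA B hB a h2]
  obtain ⟨Tri, hTri⟩ : ∃ S : Finset V, S = T.biUnion id := ⟨_, rfl⟩
  have memTri : ∀ x, x ∈ Tri ↔ ∃ A ∈ T, x ∈ A := by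
    intro x
    simp [hTri]
  have cardTri : #Tri = 9 := by
    rw [hTri, card_biUnion]
    · rw [sum_congr rfl (g := fun _ => 3)]
      · simp [hT3]
      · exact cardA
    · intro A hA B hB hAB
      change Disjoint A B
      rw [Finset.disjoint_left]
      exact fun a h1 h2 => hAB (disj A hA B hB a h1 h2)
  have nte : ∀ x, x ∉ Tri → ∀ w, ¬ TE G x w := by
    rintro x hx w ⟨h1, y, h2, h3⟩
    exact hx ((memTri x).2 ⟨{x, w, y}, mkT x w y h1 h2 h3, by simp⟩)
  have td0 : ∀ x, x ∉ Tri → td G x = 0 := by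
    intro x hx
    simp [td, nte x hx]
  have teErase : ∀ A ∈ T, ∀ a ∈ A, ({w | TE G a w} : Finset V) = A.erase a := by
    intro A hA a ha
    ext w
    simp only [mem_filter, mem_univ, true_and, mem_erase, memA A hA a ha]
    constructor
    · exact fun h => ⟨h.1.ne', Or.inr h⟩
    · rintro ⟨h, h' | h'⟩
      · exact (h h').elim
      · exact h'
  have td2 : ∀ x ∈ Tri, td G x = 2 := by
    intro x hx
    obtain ⟨A, hA, hxA⟩ := (memTri x).1 hx
    unfold td
    rw [teErase A hA x hxA, card_erase_of_mem hxA, cardA A hA]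
  obtain ⟨t, ht⟩ : ∃ t : V → ℕ, ∀ v, t v = #{w | NE G v w ∧ w ∈ Tri} := ⟨_, fun _ => rfl⟩
  have sumtd : ∀ v, ∑ w with NE G v w, td G w = 2 * t v := by
    intro v
    rw [ht, ← filter_filter, card_filter, mul_sum]
    apply sum_congr rfl
    intro w _
    split_ifs with h
    · simp [td2 w h]
    · simp [td0 w h]
  have tle : ∀ v, t v ≤ nd G v := by
    intro v
    rw [ht]
    apply card_le_card
    intro w
    simp
    tauto
  have fS : ∀ x, x ∉ Tri →
      4 * t x + nd G x * nd G x + 2 + 2 * nd G x = 2 * Fintype.card V + nd G x := by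
    intro x hx
    have h := L.count x
    rw [sumtd, td0 x hx] at h
    simp [nte x hx] at h
    omega
  have fT : ∀ A ∈ T, ∀ a ∈ A, 2 * (∑ w ∈ A, nd G w) + 4 * t a + nd G a * nd G a + 6
      = 2 * Fintype.card V + nd G a := by
    intro A hA a ha
    have h := L.count a
    rw [sumtd, td2 a ((memTri a).2 ⟨A, hA, ha⟩), teErase A hA a ha] at h
    have := sum_erase_add A (nd G) ha
    omega
  have one : ∀ A ∈ T, ∀ B ∈ T, A ≠ B → ∀ a ∈ A, ∀ a' ∈ A, ∀ b ∈ B, ∀ b' ∈ B,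
      G.Adj a b → G.Adj a' b' → a = a' ∧ b = b' := by
    intro A hA B hB hAB a ha a' ha' b hb b' hb' h h'
    have nTE : ¬ TE G a b := fun k =>
      hAB (disj A hA B hB b ((memA A hA a ha b).2 (Or.inr k)) hb)
    have eqa : a = a' := by
      by_contra hne
      obtain ⟨h1, x, h2, h3⟩ := teA A hA a ha a' ha' hne
      have hn : ¬ G.Adj a' b := fun k => nTE ⟨h, a', h1, k.symm⟩
      have hbb : b ≠ b' := by rintro rfl; exact hn h'
      refine L.u2 a' b a b' x ?_ hn h1.symm h.symm h' (adjA B hB b hb b' hb' hbb) ?_ h3 h2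
      · rintro rfl
        exact hAB (disj A hA B hB _ ha' hb)
      · rintro rfl
        exact hAB (disj A hA B hB _ ha hb')
    refine ⟨eqa, ?_⟩
    subst eqa
    by_contra hne
    exact nTE ⟨h, b', h', adjA B hB b hb b' hb' hne⟩
  have ndpos : ∀ A ∈ T, ∀ a ∈ A, 1 ≤ nd G a := by
    intro A hA a ha
    by_contra h0
    have h0' : ∀ w, ¬ NE G a w := by
      have : nd G a = 0 := by omega
      simpa [nd, filter_eq_empty_iff] using this
    have ain : ∀ w, G.Adj a w → w ∈ A := fun w h =>
      (memA A hA a ha w).2 (Or.inr ((te_or_ne h).resolve_right (h0' w)))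
    obtain ⟨B, hB, hBA⟩ : ∃ B ∈ T, B ≠ A := exists_mem_ne (by rw [hT3]; norm_num) A
    have nb : ∀ b ∈ B, ∃ w ∈ A, G.Adj w b := by
      intro b hb
      have hbA : b ∉ A := fun k => hBA (disj B hB A hA b hb k)
      rcases L.ex a b (by rintro rfl; exact hbA ha) (fun k => hbA (ain b k)) with
        ⟨p, q, -, h1, h2, -⟩ | ⟨p, q, h1, h2, -⟩
      · exact ⟨p, ain p h1, h2.symm⟩
      · exact ⟨p, ain p h1, h2.symm⟩
    obtain ⟨b, hb, b', hb', hbb⟩ := one_lt_card.1 (show 1 < #B by rw [cardA B hB]; norm_num)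
    obtain ⟨w, hw, h1⟩ := nb b hb
    obtain ⟨w', hw', h1'⟩ := nb b' hb'
    exact hbb (one A hA B hB hBA.symm w hw w' hw' b hb b' hb' h1 h1').2
  have t3 : ∀ x, x ∉ Tri → t x ≤ 3 := by
    intro x hx
    have h1 : ({w | NE G x w ∧ w ∈ Tri} : Finset V) ⊆ T.biUnion (fun B => B.filter (NE G x)) := by
      intro w
      simp [memTri]
      intro h A hA hw
      exact ⟨A, hA, hw, h⟩
    rw [ht]
    refine (card_le_card h1).trans (card_biUnion_le.trans ?_)
    calc _ ≤ ∑ B ∈ T, 1 := by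
          apply sum_le_sum
          intro B hB
          rw [card_le_one]
          intro b hb b' hb'
          simp at hb hb'
          by_contra hne
          exact hb.2.2 b' hb'.2.1 (adjA B hB b hb.1 b' hb'.1 hne)
      _ = 3 := by simp [hT3]
  have t2 : ∀ A ∈ T, ∑ a ∈ A, t a ≤ 2 := by
    intro A hA
    have h1 : ∀ a ∈ A, t a ≤ ∑ B ∈ T.erase A, #(B.filter (NE G a)) := by
      intro a ha
      have h1 : ({w | NE G a w ∧ w ∈ Tri} : Finset V) ⊆
          (T.erase A).biUnion (fun B => B.filter (NE G a)) := by
        intro w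
        simp [memTri]
        intro h B hB hw
        refine ⟨B, ⟨?_, hB⟩, hw, h⟩
        rintro rfl
        exact (teA B hB a ha w hw h.1.ne).not_ne h
      rw [ht]
      exact (card_le_card h1).trans card_biUnion_le
    refine (sum_le_sum h1).trans ?_
    rw [sum_comm]
    calc _ ≤ ∑ B ∈ T.erase A, 1 := by
          apply sum_le_sum
          intro B hB
          rw [mem_erase] at hB
          rw [← card_sigma, card_le_one]
          rintro ⟨a, b⟩ h ⟨a', b'⟩ h'
          simp at h h'
          obtain ⟨rfl, rfl⟩ := one A hA B hB.2 hB.1.symm a h.1 a' h'.1 b h.2.1 b' h'.2.1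
            h.2.2.1 h'.2.2.1
          rfl
      _ = 2 := by simp [hT3, card_erase_of_mem hA]
  have ndS : ∀ x, x ∉ Tri → ∀ y, y ∉ Tri → nd G x = nd G y := by
    intro x hx y hy
    by_cases hxy : x = y
    · rw [hxy]
    have ne : ∀ z, z ∉ Tri → ∀ w, G.Adj z w → NE G z w := fun z hz w h =>
      (te_or_ne h).resolve_left (nte z hz w)
    by_cases h : G.Adj x y
    · exact L.nd_eq (ne x hx y h)
    · rcases L.ex x y hxy h with ⟨p, q, -, h1, h2, -⟩ | ⟨p, q, h1, h2, -⟩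
      · rw [L.nd_eq (ne x hx p h1), L.nd_eq (ne y hy p h2)]
      · rw [L.nd_eq (ne x hx p h1), L.nd_eq (ne y hy p h2)]
  have exS : ∀ a, t a < nd G a → ∃ x, x ∉ Tri ∧ NE G a x := by
    intro a h
    by_contra hh
    push Not at hh
    have : nd G a ≤ t a := by
      rw [ht]
      apply card_le_card
      intro w
      simp
      intro hw
      refine ⟨hw, ?_⟩
      by_contra k
      exact hh w k hw
    omega
  have case1 : ∀ a b c, ({a, b, c} : Finset V) ∈ T → a ≠ b → a ≠ c → b ≠ c →
      t a < nd G a → t b < nd G b → False := by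
    intro a b c hA hab hac hbc ha hb
    obtain ⟨x, hx, hax⟩ := exS a ha
    obtain ⟨y, hy, hby⟩ := exS b hb
    have e1 := L.nd_eq hax
    have e2 := L.nd_eq hby
    have e3 := ndS x hx y hy
    have f1 := fS x hx
    have f2 := fT _ hA a (by simp)
    have f3 := fT _ hA b (by simp)
    have hc := ndpos _ hA c (by simp)
    have htx := t3 x hx
    have htx' := tle x
    have hn : 10 ≤ Fintype.card V := by
      have : #(insert x Tri) ≤ Fintype.card V := card_le_univ _
      rw [card_insert_of_notMem hx, cardTri] at this
      exact this
    rw [sum_insert (by simp [hab, hac]), sum_pair hbc] at f2 f3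
    have eb : nd G b = nd G a := by omega
    have ex' : nd G x = nd G a := by omega
    rw [eb] at f2 f3
    rw [ex'] at f1 htx'
    have hd : nd G a ≤ 3 := by omega
    have hd3 : nd G a = 3 := by
      generalize nd G a = d at *
      interval_cases d <;> omega
    rw [hd3] at f1 f2 f3
    have ta : t a = 0 := by omega
    have tb : t b = 0 := by omega
    have card13 : Fintype.card V = 13 := by omega
    have out : ∀ v, t v = 0 → ∀ w, NE G v w → w ∉ Tri := by
      intro v hv w hw hw'
      rw [ht, card_eq_zero] at hv
      have : w ∈ ({w | NE G v w ∧ w ∈ Tri} : Finset V) := by simp [hw, hw']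
      rw [hv] at this
      simp at this
    have d1 : Disjoint ({w | NE G a w} : Finset V) ({w | NE G b w} : Finset V) := by
      rw [Finset.disjoint_left]
      intro w h1 h2
      simp at h1 h2
      exact h1.2 b (adjA _ hA a (by simp) b (by simp) hab) h2.1.symm
    have d2 : Disjoint (({w | NE G a w} : Finset V) ∪ ({w | NE G b w} : Finset V)) Tri := by
      rw [Finset.disjoint_left]
      intro w h1
      simp at h1
      rcases h1 with h1 | h1
      · exact out a ta w h1
      · exact out b tb w h1
    have := card_le_univ ((({w | NE G a w} : Finset V) ∪ ({w | NE G b w} : Finset V)) ∪ Tri)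
    rw [card_union_of_disjoint d2, card_union_of_disjoint d1, cardTri, card13] at this
    unfold nd at hd3 eb
    omega
  have case2 : ∀ a b c, ({a, b, c} : Finset V) ∈ T → a ≠ b → a ≠ c → b ≠ c →
      t a < nd G a → nd G b ≤ t b → nd G c ≤ t c → False := by
    intro a b c hA hab hac hbc ha hb hc
    obtain ⟨x, hx, hax⟩ := exS a ha
    have e1 := L.nd_eq hax
    have f1 := fS x hx
    have f2 := fT _ hA a (by simp)
    have f3 := fT _ hA b (by simp)
    have pb := ndpos _ hA b (by simp)
    have pc := ndpos _ hA c (by simp)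
    have s2 := t2 _ hA
    rw [sum_insert (by simp [hab, hac]), sum_pair hbc] at f2 f3 s2
    have lb := tle b
    have lc := tle c
    have b1 : nd G b = 1 := by omega
    have c1 : nd G c = 1 := by omega
    have tb : t b = 1 := by omega
    have ta : t a = 0 := by omega
    rw [b1, c1, ta] at f2
    rw [b1, c1, tb] at f3
    rw [← e1] at f1
    have tx := t3 x hx
    have hd : nd G a * nd G a = nd G a + 4 := by omega
    have hd' : nd G a ≤ 3 := by nlinarith
    generalize nd G a = d at *
    interval_cases d <;> omega
  obtain ⟨A, hA⟩ : ∃ A, A ∈ T := card_pos.1 (by omega)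
  obtain ⟨a, b, c, hab, hac, hbc, rfl⟩ := card_eq_three.1 (cardA A hA)
  have s2 := t2 _ hA
  rw [sum_insert (by simp [hab, hac]), sum_pair hbc] at s2
  have pa := ndpos _ hA a (by simp)
  have pb := ndpos _ hA b (by simp)
  have pc := ndpos _ hA c (by simp)
  have rot1 : ({b, a, c} : Finset V) ∈ T := by
    rw [insert_comm]
    exact hA
  have rot2 : ({c, a, b} : Finset V) ∈ T := by
    rw [insert_comm, pair_comm]
    exact hA
  have rot3 : ({a, c, b} : Finset V) ∈ T := by
    rw [pair_comm]
    exact hA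
  have rot4 : ({b, c, a} : Finset V) ∈ T := by
    rw [pair_comm]
    exact rot1
  by_cases ga : t a < nd G a
  · by_cases gb : t b < nd G b
    · exact case1 a b c hA hab hac hbc ga gb
    · by_cases gc : t c < nd G c
      · exact case1 a c b rot3 hac hab hbc.symm ga gc
      · exact case2 a b c hA hab hac hbc ga (by omega) (by omega)
  · by_cases gb : t b < nd G b
    · by_cases gc : t c < nd G c
      · exact case1 b c a rot4 hbc hab.symm hac.symm gb gc
      · exact case2 b a c rot1 hab.symm hbc hac gb (by omega) (by omega)
    · exact case2 c a b rot2 hac.symm hbc.symm hab (by omega) (by omega) (by omega)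

end Main

theorem stmt14 {V : Type*} [Fintype V] (G : SimpleGraph V)
    (hcount : (G.cliqueSet 3).ncard = 3) :
    ¬ UniquelySaturated diamond G :=
  fun h => (loc_of_sat G h).main hcount
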